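/- arXiv:1802.03854 — 4 statements merged into one kernel-verified Lean document; each statement's English description precedes it below -/
import Mathlib

section
/- Let ξ = e^{2πi/6} and let Λ = (ℤ + 2ξℤ)(ξe_1 − e_2) + (ℤ + 2ξℤ)(1−ξ)(e_1 − e_2) ⊆ ℂ² (a G(6,3,2)-invariant ℤ-lattice of full rank 4). Then the affine reflection group W = G(6,3,2) ⋉ Λ does NOT have the Steinberg property: there exist a non-identity element g ∈ W and a point u ∈ ℂ² with g(u) = u such that u lies on no reflecting hyperplane of W. (For example, g(v) = −v + (e_1 + (ξ² − 1)e_2) is such an element, where ξ² = e^{2πi/3}.) -/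
open Matrix Complex

noncomputable section

/-- `ℤ[ζ] = ℤ + ℤζ` as a subset of `ℂ`. -/
def Zlat (ζ : ℂ) : Set ℂ := {z | ∃ a b : ℤ, z = (a : ℂ) + (b : ℂ) * ζ}

/-- Membership in the complex reflection group `G(r,p,n)`: monomial matrices whose
nonzero entries are `r`-th roots of unity and whose product of nonzero entries,
raised to the power `r / p`, equals `1`. -/
def IsGrpn (r p n : ℕ) (M : Matrix (Fin n) (Fin n) ℂ) : Prop :=
  (∀ i, ∃! j, M i j ≠ 0) ∧ (∀ j, ∃! i, M i j ≠ 0) ∧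
  (∀ i j, M i j ≠ 0 → M i j ^ r = 1) ∧
  (∏ i, ∑ j, M i j) ^ (r / p) = 1

/-- The affine transformation `v ↦ M v + t` encoded by the pair `g = (M, t)`. -/
def applyAff {n : ℕ} (g : Matrix (Fin n) (Fin n) ℂ × (Fin n → ℂ)) (v : Fin n → ℂ) :
    Fin n → ℂ :=
  g.1.mulVec v + g.2

/-- An affine hyperplane in `ℂⁿ`: the solution set of a nonzero affine-linear equation. -/
def IsAffineHyperplane {n : ℕ} (H : Set (Fin n → ℂ)) : Prop :=
  ∃ a : Fin n → ℂ, a ≠ 0 ∧ ∃ c : ℂ, H = {v | ∑ i, a i * v i = c}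

/-- A reflecting hyperplane of `W`: an affine hyperplane fixed pointwise by some
non-identity element of `W`. -/
def IsReflectingHyperplane {n : ℕ}
    (W : Matrix (Fin n) (Fin n) ℂ × (Fin n → ℂ) → Prop) (H : Set (Fin n → ℂ)) : Prop :=
  IsAffineHyperplane H ∧
  ∃ g, W g ∧ (∃ v, applyAff g v ≠ v) ∧ ∀ v ∈ H, applyAff g v = v

/-- `W` has the Steinberg property: every point fixed by some non-identity element
of `W` lies on a reflecting hyperplane of `W`. -/
def SteinbergProperty {n : ℕ}
    (W : Matrix (Fin n) (Fin n) ℂ × (Fin n → ℂ) → Prop) : Prop :=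
  ∀ u : Fin n → ℂ,
    (∃ g, W g ∧ (∃ v, applyAff g v ≠ v) ∧ applyAff g u = u) →
    ∃ H, IsReflectingHyperplane W H ∧ u ∈ H

/-- `stdGen n 0 = e₁` and, for `j ≥ 1` (0-indexed), `stdGen n j = e_{j-1} - e_j`. -/
def stdGen (n : ℕ) (j : Fin n) : Fin n → ℂ := fun i =>
  if i = j then (if (j : ℕ) = 0 then 1 else -1)
  else if (i : ℕ) + 1 = (j : ℕ) then 1 else 0

/-- `genB n ξ 0 = ξ e₁ - e₂` and, for `j ≥ 1` (0-indexed), `genB n ξ j = e_{j-1} - e_j`. -/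
def genB (n : ℕ) (ξ : ℂ) (j : Fin n) : Fin n → ℂ :=
  if (j : ℕ) = 0 then
    (fun i => if (i : ℕ) = 0 then ξ else if (i : ℕ) = 1 then -1 else 0)
  else stdGen n j

/-- The primitive sixth root of unity satisfies `ξ² = ξ - 1`. -/
theorem exp_sixth_sq :
    Complex.exp (2 * Real.pi * Complex.I / 6) ^ 2 =
      Complex.exp (2 * Real.pi * Complex.I / 6) - 1 := by
  have h : (2 * Real.pi * Complex.I / 6 : ℂ) = ((Real.pi / 3 : ℝ) : ℂ) * Complex.I := by
    push_cast; ring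
  have h3 : ((√3 : ℝ) : ℂ) ^ 2 = 3 := by
    norm_cast
    exact Real.sq_sqrt (by norm_num)
  rw [h, Complex.exp_mul_I, ← Complex.ofReal_cos, ← Complex.ofReal_sin,
    Real.cos_pi_div_three, Real.sin_pi_div_three]
  push_cast
  linear_combination (1 / 4 : ℂ) * Complex.I ^ 2 * h3 + (3 / 4 : ℂ) * Complex.I_sq

/-- `1` and a root of `X² - X + 1` are linearly independent over `ℤ`. -/
theorem int_add_mul_eq_zero {ξ : ℂ} (hξ : ξ ^ 2 = ξ - 1) {a b : ℤ}
    (h : (a : ℂ) + b * ξ = 0) : a = 0 ∧ b = 0 := by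
  have key : a ^ 2 + a * b + b ^ 2 = 0 := by
    have : (a : ℂ) ^ 2 + a * b + b ^ 2 = 0 := by
      linear_combination (a + b * (1 - ξ) : ℂ) * h + (b : ℂ) ^ 2 * hξ
    exact_mod_cast this
  have hb : b = 0 := by nlinarith [sq_nonneg (2 * a + b), sq_nonneg b]
  subst hb
  exact ⟨by simpa using key, rfl⟩

/-- Coordinates of twice a point of `ℤ[2ξ](ξ, -1) + ℤ[2ξ](1 - ξ)(1, -1)` in the basis `1, ξ`. -/
theorem lattice_coords {ξ c d : ℂ} (hξ : ξ ^ 2 = ξ - 1)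
    (hc : c ∈ Zlat (2 * ξ)) (hd : d ∈ Zlat (2 * ξ)) {t : Fin 2 → ℂ}
    (ht : t = c • ![ξ, -1] + d • ((1 - ξ) • ![1, -1])) {m n k l : ℤ}
    (h0 : 2 * t 0 = m + n * ξ) (h1 : 2 * t 1 = k + l * ξ) :
    ∃ a b a' b' : ℤ, m = 2 * (a' + 2 * b' - 2 * b) ∧ n = 2 * (a + 2 * b - a') ∧
      k = 2 * (-a - a' - 2 * b') ∧ l = 2 * (a' - 2 * b) := by
  obtain ⟨a, b, rfl⟩ := hc
  obtain ⟨a', b', rfl⟩ := hd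
  have e0 := congrFun ht 0
  have e1 := congrFun ht 1
  simp at e0 e1
  have f0 := int_add_mul_eq_zero hξ (a := m - 2 * (a' + 2 * b' - 2 * b))
    (b := n - 2 * (a + 2 * b - a')) (by
      push_cast
      linear_combination 2 * e0 - h0 + (4 * b - 4 * b' : ℂ) * hξ)
  have f1 := int_add_mul_eq_zero hξ (a := k - 2 * (-a - a' - 2 * b'))
    (b := l - 2 * (a' - 2 * b)) (by
      push_cast
      linear_combination 2 * e1 - h1 + (4 * b' : ℂ) * hξ)
  exact ⟨a, b, a', b', by omega, by omega, by omega, by omega⟩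

/-- The sixth roots of unity in terms of a root of `X² - X + 1`. -/
theorem sixth_root_cases {ξ p : ℂ} (hξ : ξ ^ 2 = ξ - 1) (hp : p ^ 6 = 1) :
    p = 1 ∨ p = -1 ∨ p = ξ ∨ p = -ξ ∨ p = 1 - ξ ∨ p = ξ - 1 := by
  have h : (p - 1) * ((p + 1) * ((p - ξ) * ((p + ξ) * ((p - (1 - ξ)) * (p - (ξ - 1)))))) = 0 := by
    have e1 : (p - ξ) * (p - (1 - ξ)) = p ^ 2 - p + 1 := by linear_combination -hξ
    have e2 : (p + ξ) * (p - (ξ - 1)) = p ^ 2 + p + 1 := by linear_combination -hξ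
    calc _ = (p - 1) * (p + 1) * ((p - ξ) * (p - (1 - ξ))) * ((p + ξ) * (p - (ξ - 1))) := by ring
      _ = p ^ 6 - 1 := by rw [e1, e2]; ring
      _ = 0 := by rw [hp, sub_self]
  simp only [mul_eq_zero] at h
  rcases h with h | h | h | h | h | h
  · exact .inl (sub_eq_zero.mp h)
  · exact .inr (.inl (eq_neg_of_add_eq_zero_left h))
  · exact .inr (.inr (.inl (sub_eq_zero.mp h)))
  · exact .inr (.inr (.inr (.inl (eq_neg_of_add_eq_zero_left h))))
  · exact .inr (.inr (.inr (.inr (.inl (sub_eq_zero.mp h)))))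
  · exact .inr (.inr (.inr (.inr (.inr (sub_eq_zero.mp h)))))

/-- A `2 × 2` monomial matrix is diagonal or antidiagonal. -/
theorem IsGrpn.diag_or_antidiag {r p : ℕ} {M : Matrix (Fin 2) (Fin 2) ℂ} (h : IsGrpn r p 2 M) :
    (M 0 1 = 0 ∧ M 1 0 = 0 ∧ M 0 0 ≠ 0 ∧ M 1 1 ≠ 0) ∨
      (M 0 0 = 0 ∧ M 1 1 = 0 ∧ M 0 1 ≠ 0 ∧ M 1 0 ≠ 0) := by
  obtain ⟨hr, hc, -, -⟩ := h
  have r0 := hr 0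
  have r1 := hr 1
  have c0 := hc 0
  have c1 := hc 1
  simp only [ExistsUnique, Fin.exists_fin_two, Fin.forall_fin_two] at r0 r1 c0 c1
  simp at r0 r1 c0 c1
  tauto

/-- If `g` fixes an affine line of `ℂ²` pointwise, its linear part fixes a nonzero vector. -/
theorem IsAffineHyperplane.exists_fixed_direction {H : Set (Fin 2 → ℂ)}
    (hH : IsAffineHyperplane H) {g : Matrix (Fin 2) (Fin 2) ℂ × (Fin 2 → ℂ)}
    (hg : ∀ v ∈ H, applyAff g v = v) {u : Fin 2 → ℂ} (hu : u ∈ H) :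
    ∃ w : Fin 2 → ℂ, w ≠ 0 ∧ g.1.mulVec w = w := by
  obtain ⟨a, ha, c, rfl⟩ := hH
  refine ⟨![-a 1, a 0], fun h => ha ?_, ?_⟩
  · have h0 := congrFun h 0
    have h1 := congrFun h 1
    simp at h0 h1
    ext i
    fin_cases i <;> simp [h0, h1]
  · have h1 := hg u hu
    have h2 := hg (u + ![-a 1, a 0]) (by
      simp only [Set.mem_ofPred_eq, Fin.sum_univ_two] at hu ⊢
      simp
      linear_combination hu)
    simp only [applyAff, Matrix.mulVec_add] at h1 h2
    have h3 : g.1.mulVec u + g.1.mulVec ![-a 1, a 0] + g.2 =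
        (g.1.mulVec u + g.2) + ![-a 1, a 0] := by rw [h2, h1]
    rw [add_right_comm] at h3
    exact add_left_cancel h3

/-- The possible translation parts of a non-identity affine map fixing `u` whose linear part lies
in `G(6,3,2)` and fixes a nonzero vector: the linear part is `diag(1, -1)`, `diag(-1, 1)` or
antidiagonal with entries `p, p⁻¹`. -/
theorem reflection_cases {g : Matrix (Fin 2) (Fin 2) ℂ × (Fin 2 → ℂ)} (hG : IsGrpn 6 3 2 g.1)
    (hne : ∃ v, applyAff g v ≠ v) {u w : Fin 2 → ℂ} (hu : applyAff g u = u) (hw : w ≠ 0)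
    (hgw : g.1.mulVec w = w) :
    (g.2 0 = 0 ∧ g.2 1 = 2 * u 1) ∨ (g.2 0 = 2 * u 0 ∧ g.2 1 = 0) ∨
      ∃ p q : ℂ, p ^ 6 = 1 ∧ p * q = 1 ∧ g.2 0 = u 0 - p * u 1 ∧ g.2 1 = u 1 - q * u 0 := by
  have w0 := congrFun hgw 0
  have w1 := congrFun hgw 1
  have u0 := congrFun hu 0
  have u1 := congrFun hu 1
  simp only [applyAff, Pi.add_apply, Matrix.mulVec, dotProduct, Fin.sum_univ_two] at w0 w1 u0 u1
  have hdet := hG.2.2.2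
  simp only [Fin.prod_univ_two, Fin.sum_univ_two] at hdet
  have hw' : ¬ (w 0 = 0 ∧ w 1 = 0) := fun h => hw (by ext i; fin_cases i <;> simp [h.1, h.2])
  have not_both_one : ¬ (g.1 0 0 = 1 ∧ g.1 1 1 = 1 ∧ g.1 0 1 = 0 ∧ g.1 1 0 = 0) := by
    rintro ⟨h1, h2, h3, h4⟩
    obtain ⟨v, hv⟩ := hne
    rw [h1, h3] at u0
    rw [h2, h4] at u1
    have t0 : g.2 0 = 0 := by linear_combination u0
    have t1 : g.2 1 = 0 := by linear_combination u1
    apply hv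
    ext i
    fin_cases i <;> simp [applyAff, h1, h2, h3, h4, t0, t1]
  rcases hG.diag_or_antidiag with ⟨h01, h10, -, -⟩ | ⟨h00, h11, hp, -⟩
  · simp only [h01, h10, zero_mul, add_zero, zero_add] at w0 w1 u0 u1 hdet
    have hd : (g.1 0 0 * g.1 1 1 - 1) * (g.1 0 0 * g.1 1 1 + 1) = 0 := by
      linear_combination hdet
    have h0 : (g.1 0 0 - 1) * w 0 = 0 := by linear_combination w0
    have h1 : (g.1 1 1 - 1) * w 1 = 0 := by linear_combination w1
    have hone : g.1 0 0 = 1 ∨ g.1 1 1 = 1 := by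
      rcases mul_eq_zero.mp h0 with h | h
      · exact .inl (sub_eq_zero.mp h)
      · exact .inr (sub_eq_zero.mp ((mul_eq_zero.mp h1).resolve_right fun h' => hw' ⟨h, h'⟩))
    rcases hone with h | h
    · rw [h, one_mul] at hd
      have h' : g.1 1 1 + 1 = 0 :=
        (mul_eq_zero.mp hd).resolve_left fun h' => not_both_one ⟨h, sub_eq_zero.mp h', h01, h10⟩
      rw [h] at u0
      exact .inl ⟨by linear_combination u0, by linear_combination u1 - u 1 * h'⟩
    · rw [h, mul_one] at hd
      have h' : g.1 0 0 + 1 = 0 :=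
        (mul_eq_zero.mp hd).resolve_left fun h' => not_both_one ⟨sub_eq_zero.mp h', h, h01, h10⟩
      rw [h] at u1
      exact .inr (.inl ⟨by linear_combination u0 - u 0 * h', by linear_combination u1⟩)
  · simp only [h00, h11, zero_mul, add_zero, zero_add] at w0 w1 u0 u1
    refine .inr (.inr ⟨g.1 0 1, g.1 1 0, hG.2.2.1 0 1 hp, ?_, by linear_combination u0,
      by linear_combination u1⟩)
    have hw0 : w 0 ≠ 0 := fun h => hw' ⟨h, by rw [← w1, h, mul_zero]⟩
    exact mul_right_cancel₀ hw0 (by linear_combination g.1 0 1 * w1 + w0)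

/-- The group `[G(6,3,2)]₂`, with lattice
`Λ = ℤ[2ξ](ξe₁ - e₂) + ℤ[2ξ](1-ξ)(e₁ - e₂)` for `ξ = e^{2πi/6}`,
fails the Steinberg property. -/
theorem not_steinberg_G_6_3_2_lattice2
    (ξ : ℂ) (hξ : ξ = Complex.exp (2 * Real.pi * Complex.I / 6))
    (Λ : Set (Fin 2 → ℂ))
    (hΛ : Λ = {v | ∃ c d : ℂ, c ∈ Zlat (2 * ξ) ∧ d ∈ Zlat (2 * ξ) ∧
      v = c • ![ξ, -1] + d • ((1 - ξ) • ![1, -1])}) :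
    ∃ g, (IsGrpn 6 3 2 g.1 ∧ g.2 ∈ Λ) ∧ (∃ v, applyAff g v ≠ v) ∧
      ∃ u : Fin 2 → ℂ, applyAff g u = u ∧
        ∀ H, IsReflectingHyperplane (fun h => IsGrpn 6 3 2 h.1 ∧ h.2 ∈ Λ) H → u ∉ H := by
  have h2 : ξ ^ 2 = ξ - 1 := hξ ▸ exp_sixth_sq
  refine ⟨(!![-1, 0; 0, -1], ![1, ξ - 2]), ⟨?_, ?_⟩, ⟨0, fun h => ?_⟩,
    ![1 / 2, (ξ - 2) / 2], ?_, ?_⟩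
  · refine ⟨?_, ?_, ?_, ?_⟩ <;>
      simp [ExistsUnique, Fin.forall_fin_two, Fin.exists_fin_two, Fin.prod_univ_two,
        Fin.sum_univ_two, Even.neg_one_pow (show Even 6 by decide)]
  · rw [hΛ]
    refine ⟨1, 1, ⟨1, 0, by simp⟩, ⟨1, 0, by simp⟩, ?_⟩
    ext i
    fin_cases i <;> simp
    ring
  · simpa [applyAff] using congrFun h 0
  · ext i
    fin_cases i <;> simp [applyAff] <;> ring
  · rintro H ⟨hH, g, ⟨hG, ht⟩, hne, hfix⟩ hu
    rw [hΛ] at ht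
    obtain ⟨c, d, hc, hd, ht⟩ := ht
    obtain ⟨w, hw, hgw⟩ := hH.exists_fixed_direction hfix hu
    have coords {m n k l : ℤ} := lattice_coords h2 hc hd ht (m := m) (n := n) (k := k) (l := l)
    rcases reflection_cases hG hne (hfix _ hu) hw hgw with
      ⟨t0, t1⟩ | ⟨t0, t1⟩ | ⟨p, q, hp, hpq, t0, t1⟩
    · obtain ⟨a, b, a', b', h⟩ := coords (m := 0) (n := 0) (k := -4) (l := 2)
        (by simp [t0]) (by simp [t1]; ring)
      omega
    · obtain ⟨a, b, a', b', h⟩ := coords (m := 2) (n := 0) (k := 0) (l := 0)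
        (by simp [t0]) (by simp [t1])
      omega
    · simp at t0 t1
      have hp0 : p ≠ 0 := left_ne_zero_of_mul_eq_one hpq
      have inv {z : ℂ} (hz : p * z = 1) : q = z := mul_left_cancel₀ hp0 (hpq.trans hz.symm)
      rcases sixth_root_cases h2 hp with rfl | rfl | hpξ | rfl | rfl | rfl
      · have hq := inv (z := 1) (by ring)
        rw [hq] at t1
        obtain ⟨a, b, a', b', h⟩ := coords (m := 3) (n := -1) (k := -3) (l := 1)
          (by rw [t0]; push_cast; ring) (by rw [t1]; push_cast; ring)
        omega
      · have hq := inv (z := -1) (by ring)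
        rw [hq] at t1
        obtain ⟨a, b, a', b', h⟩ := coords (m := -1) (n := 1) (k := -1) (l := 1)
          (by rw [t0]; push_cast; ring) (by rw [t1]; push_cast; ring)
        omega
      · subst p
        have hq := inv (z := 1 - ξ) (by linear_combination (-1 : ℂ) * h2)
        rw [hq] at t1
        obtain ⟨a, b, a', b', h⟩ := coords (m := 2) (n := 1) (k := -3) (l := 2)
          (by rw [t0]; push_cast; linear_combination (-1 : ℂ) * h2) (by rw [t1]; push_cast; ring)
        omega
      · have hq := inv (z := ξ - 1) (by linear_combination (-1 : ℂ) * h2)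
        rw [hq] at t1
        obtain ⟨a, b, a', b', h⟩ := coords (m := 0) (n := -1) (k := -1) (l := 0)
          (by rw [t0]; push_cast; linear_combination (1 : ℂ) * h2) (by rw [t1]; push_cast; ring)
        omega
      · have hq := inv (z := ξ) (by linear_combination (-1 : ℂ) * h2)
        rw [hq] at t1
        obtain ⟨a, b, a', b', h⟩ := coords (m := 2) (n := -2) (k := -2) (l := 0)
          (by rw [t0]; push_cast; linear_combination (1 : ℂ) * h2) (by rw [t1]; push_cast; ring)
        omega
      · have hq := inv (z := -ξ) (by linear_combination (-1 : ℂ) * h2)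
        rw [hq] at t1
        obtain ⟨a, b, a', b', h⟩ := coords (m := 0) (n := 2) (k := -2) (l := 2)
          (by rw [t0]; push_cast; linear_combination (-1 : ℂ) * h2) (by rw [t1]; push_cast; ring)
        omega
end
end

section
/- Let n ≥ 2, let α ∈ ℂ \ ℝ, and let Λ_α = Σ_{j=2}^{n} (ℤ + ℤα)(e_{j-1} − e_j) ⊆ ℂⁿ (invariant under the group of n×n permutation matrices). Let W be the group of affine transformations of ℂⁿ of the form v ↦ σv + λ with σ an n×n permutation matrix and λ ∈ Λ_α. Then W has the Steinberg property: every point of ℂⁿ fixed by some non-identity element of W lies on a reflecting hyperplane of W. -/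
open Matrix Complex

noncomputable section

/-- `M` is an `n × n` permutation matrix. -/
def IsPermMatrix {n : ℕ} (M : Matrix (Fin n) (Fin n) ℂ) : Prop :=
  ∃ σ : Equiv.Perm (Fin n), ∀ i j, M i j = if j = σ i then 1 else 0

theorem zlat_add {ζ z w : ℂ} (hz : z ∈ Zlat ζ) (hw : w ∈ Zlat ζ) : z + w ∈ Zlat ζ := by
  obtain ⟨a, b, rfl⟩ := hz
  obtain ⟨c, d, rfl⟩ := hw
  exact ⟨a + c, b + d, by push_cast; ring⟩

theorem zlat_int_mul {ζ z : ℂ} (k : ℤ) (hz : z ∈ Zlat ζ) : (k : ℂ) * z ∈ Zlat ζ := by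
  obtain ⟨a, b, rfl⟩ := hz
  exact ⟨k * a, k * b, by push_cast; ring⟩

theorem zlat_zero (ζ : ℂ) : (0 : ℂ) ∈ Zlat ζ := ⟨0, 0, by simp⟩

theorem zlat_neg {ζ z : ℂ} (hz : z ∈ Zlat ζ) : -z ∈ Zlat ζ := by
  simpa using zlat_int_mul (-1) hz

/-- Coordinates of a combination of the vectors `e_{j-1} - e_j`. -/
theorem sum_smul_stdGen_apply {n : ℕ} (c : Fin n → ℂ) (m : Fin n) :
    (∑ j, c j • (if (j : ℕ) = 0 then 0 else stdGen n j)) m =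
      (if (m : ℕ) = 0 then 0 else -c m) +
        (if h : (m : ℕ) + 1 < n then c ⟨m + 1, h⟩ else 0) := by
  have hterm : ∀ j : Fin n, (c j • (if (j : ℕ) = 0 then 0 else stdGen n j)) m =
      (if j = m then (if (m : ℕ) = 0 then 0 else -c m) else 0) +
        (if (m : ℕ) + 1 = j then c j else 0) := by
    intro j
    by_cases hjm : j = m
    · subst hjm
      by_cases hj : (j : ℕ) = 0 <;> simp [hj, stdGen]
    · have hmj : m ≠ j := fun h => hjm h.symm
      by_cases hj : (j : ℕ) = 0
      · simp [hj, hjm]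
      · simp [hj, hjm, hmj, stdGen]
  rw [Finset.sum_apply, Finset.sum_congr rfl fun j _ => hterm j, Finset.sum_add_distrib]
  congr 1
  · simp
  · split_ifs with h
    · rw [Finset.sum_eq_single ⟨m + 1, h⟩]
      · simp
      · intro j _ hj
        rw [if_neg]
        exact fun h' => hj (Fin.ext h'.symm)
      · simp
    · refine Finset.sum_eq_zero fun j _ => if_neg ?_
      have := j.isLt
      omega

theorem sum_smul_stdGen_apply_mem_zlat {n : ℕ} {α : ℂ} {c : Fin n → ℂ}
    (hc : ∀ j, c j ∈ Zlat α) (m : Fin n) :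
    (∑ j, c j • (if (j : ℕ) = 0 then 0 else stdGen n j)) m ∈ Zlat α := by
  rw [sum_smul_stdGen_apply]
  refine zlat_add ?_ ?_
  · split_ifs
    · exact zlat_zero α
    · exact zlat_neg (hc m)
  · split_ifs
    · exact hc _
    · exact zlat_zero α

/-- The vector `z (e_i - e_k)` is a combination of the vectors `e_{j-1} - e_j`. -/
theorem exists_sum_smul_stdGen_eq {n : ℕ} {α z : ℂ} (hz : z ∈ Zlat α) (i k : Fin n) :
    ∃ c : Fin n → ℂ, (∀ j, c j ∈ Zlat α) ∧
      (fun m => (if m = i then z else 0) - (if m = k then z else 0)) =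
        ∑ j, c j • (if (j : ℕ) = 0 then 0 else stdGen n j) := by
  refine ⟨fun j => (((if j ≤ k then 1 else 0) - (if j ≤ i then 1 else 0) : ℤ) : ℂ) * z,
    fun j => zlat_int_mul _ hz, ?_⟩
  funext m
  rw [sum_smul_stdGen_apply]
  have hi := i.isLt
  have hk := k.isLt
  simp only [Fin.ext_iff, Fin.le_def]
  split_ifs <;> first | omega | (push_cast; ring)

theorem mulVec_of_perm {n : ℕ} {M : Matrix (Fin n) (Fin n) ℂ} {σ : Equiv.Perm (Fin n)}
    (hM : ∀ i j, M i j = if j = σ i then 1 else 0) (v : Fin n → ℂ) (i : Fin n) :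
    M.mulVec v i = v (σ i) := by
  simp [Matrix.mulVec, dotProduct, hM]

/-- Steinberg's theorem for the symmetric group `𝔖ₙ` (acting by permutation matrices)
semidirect with the lattice `Λ_α = Σ_{j=2}^n (ℤ + ℤα)(e_{j-1} - e_j)`, `α ∉ ℝ`. -/
theorem steinberg_symmetric_group (n : ℕ) (hn : 2 ≤ n)
    (α : ℂ) (hα : α.im ≠ 0)
    (Λ : Set (Fin n → ℂ))
    (hΛ : Λ = {v | ∃ c : Fin n → ℂ, (∀ j, c j ∈ Zlat α) ∧
      v = ∑ j, c j • (if (j : ℕ) = 0 then 0 else stdGen n j)}) :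
    SteinbergProperty (fun g => IsPermMatrix g.1 ∧ g.2 ∈ Λ) := by
  subst hΛ
  rintro u ⟨⟨M, t⟩, ⟨⟨σ, hσ⟩, c, hc, ht⟩, ⟨v, hv⟩, hu⟩
  have hu' : ∀ i, u (σ i) + t i = u i := fun i => by
    simpa [applyAff, mulVec_of_perm hσ] using congrFun hu i
  obtain ⟨i, hi⟩ : ∃ i, σ i ≠ i := by
    by_contra! h
    refine hv (funext fun i => ?_)
    have hti := hu' i
    rw [h i] at hti
    simp only [applyAff, Pi.add_apply, mulVec_of_perm hσ, h i]
    linear_combination hti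
  have hz : t i ∈ Zlat α := by
    have hti := sum_smul_stdGen_apply_mem_zlat hc i
    rwa [← ht] at hti
  set k := σ i
  let N : Matrix (Fin n) (Fin n) ℂ := fun a b => if b = Equiv.swap i k a then 1 else 0
  let s : Fin n → ℂ := fun m => (if m = i then t i else 0) - (if m = k then t i else 0)
  have hN : ∀ (w : Fin n → ℂ) m, applyAff (N, s) w m = w (Equiv.swap i k m) + s m := fun w m => by
    simp only [applyAff, Pi.add_apply]
    rw [mulVec_of_perm (σ := Equiv.swap i k) fun _ _ => rfl]
  have heq : ∀ w : Fin n → ℂ,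
      ∑ m, (Pi.single i 1 - Pi.single k 1 : Fin n → ℂ) m * w m = w i - w k := fun w => by
    simp [sub_mul, Finset.sum_sub_distrib, Pi.single_apply]
  refine ⟨{w | ∑ m, (Pi.single i 1 - Pi.single k 1 : Fin n → ℂ) m * w m = t i},
    ⟨⟨_, fun h => ?_, t i, rfl⟩, (N, s),
      ⟨⟨Equiv.swap i k, fun _ _ => rfl⟩, exists_sum_smul_stdGen_eq hz i k⟩,
      ⟨fun m => if m = i then t i + 1 else 0, fun h => ?_⟩, fun w hw => funext fun m => ?_⟩, ?_⟩
  · simpa [hi.symm] using congrFun h i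
  · have h' := congrFun h i
    rw [hN] at h'
    simp [s, hi, hi.symm] at h'
  · rw [Set.mem_ofPred_eq, heq] at hw
    rw [hN]
    by_cases hmi : m = i
    · subst hmi
      simp only [Equiv.swap_apply_left, s, if_neg hi.symm, if_true]
      linear_combination -hw
    · by_cases hmk : m = k
      · subst hmk
        simp only [Equiv.swap_apply_right, s, if_neg hi, if_true]
        linear_combination hw
      · simp [Equiv.swap_apply_of_ne_of_ne hmi hmk, s, hmi, hmk]
  · rw [Set.mem_ofPred_eq, heq]
    linear_combination -hu' i
end
end

section
/- Let n ≥ 1, let α ∈ ℂ \ ℝ, and let Λ = (ℤ + ℤα)e_1 + Σ_{j=2}^{n} (ℤ + ℤα)(e_{j-1} − e_j) ⊆ ℂⁿ (a G(2,1,n)-invariant ℤ-lattice of full rank 2n; here G(2,1,n) is the Weyl group W(B_n) of n×n signed permutation matrices). Then the affine reflection group W = G(2,1,n) ⋉ Λ has the Steinberg property: every point of ℂⁿ fixed by some non-identity element of W lies on a reflecting hyperplane of W. -/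
open Matrix Complex

noncomputable section

/-- `ℤ + ℤζ` as an additive subgroup of `ℂ`. -/
def zlatSubgroup (ζ : ℂ) : AddSubgroup ℂ where
  carrier := Zlat ζ
  zero_mem' := ⟨0, 0, by simp⟩
  add_mem' := by
    rintro _ _ ⟨a, b, rfl⟩ ⟨c, d, rfl⟩
    exact ⟨a + c, b + d, by push_cast; ring⟩
  neg_mem' := by
    rintro _ ⟨a, b, rfl⟩
    exact ⟨-a, -b, by push_cast; ring⟩

/-- The combinations of the vectors `stdGen n j` with coefficients in `ℤ + ℤζ`,
as an additive subgroup of `ℂⁿ`. -/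
def stdLattice (n : ℕ) (ζ : ℂ) : AddSubgroup (Fin n → ℂ) where
  carrier := {v | ∃ c : Fin n → ℂ, (∀ j, c j ∈ Zlat ζ) ∧ v = ∑ j, c j • stdGen n j}
  zero_mem' := ⟨0, fun _ => (zlatSubgroup ζ).zero_mem, by simp⟩
  add_mem' := by
    rintro _ _ ⟨c, hc, rfl⟩ ⟨d, hd, rfl⟩
    exact ⟨c + d, fun j => (zlatSubgroup ζ).add_mem (hc j) (hd j), by
      simp [add_smul, Finset.sum_add_distrib]⟩
  neg_mem' := by
    rintro _ ⟨c, hc, rfl⟩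
    exact ⟨-c, fun j => (zlatSubgroup ζ).neg_mem (hc j), by simp⟩

lemma smul_stdGen_mem_stdLattice {n : ℕ} {ζ z : ℂ} (hz : z ∈ Zlat ζ) (j : Fin n) :
    z • stdGen n j ∈ stdLattice n ζ := by
  refine ⟨Pi.single j z, fun k => ?_, ?_⟩
  · rcases eq_or_ne k j with rfl | h
    · simpa using hz
    · rw [Pi.single_eq_of_ne h]
      exact (zlatSubgroup ζ).zero_mem
  · simp [Pi.single_apply, ite_smul]

lemma single_mem_stdLattice {n : ℕ} {ζ z : ℂ} (hz : z ∈ Zlat ζ) (i : Fin n) :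
    Pi.single i z ∈ stdLattice n ζ := by
  obtain ⟨i, hi⟩ := i
  induction i with
  | zero =>
    convert smul_stdGen_mem_stdLattice hz ⟨0, hi⟩ using 1
    ext k
    simp [stdGen, Pi.single_apply]
  | succ i ih =>
    convert (stdLattice n ζ).sub_mem (ih (by omega))
      (smul_stdGen_mem_stdLattice hz ⟨i + 1, hi⟩) using 1
    ext k
    simp only [stdGen, Pi.single_apply, Pi.sub_apply, Pi.smul_apply, smul_eq_mul, Fin.ext_iff]
    split_ifs <;> first | contradiction | omega | simp

lemma mem_stdLattice_iff {n : ℕ} {ζ : ℂ} {v : Fin n → ℂ} :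
    v ∈ stdLattice n ζ ↔ ∀ i, v i ∈ Zlat ζ := by
  constructor
  · rintro ⟨c, hc, rfl⟩ i
    rw [Finset.sum_apply]
    refine (zlatSubgroup ζ).sum_mem fun j _ => ?_
    have hj : c j ∈ zlatSubgroup ζ := hc j
    simp only [stdGen, Pi.smul_apply, smul_eq_mul]
    split_ifs <;> simp [hj, (zlatSubgroup ζ).zero_mem]
  · intro h
    rw [← Finset.univ_sum_single v]
    exact (stdLattice n ζ).sum_mem fun i _ => single_mem_stdLattice (h i) i

/-- The monomial matrix whose entry in row `k` is `d k`, in column `σ k`. -/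
def monomialMatrix {n : ℕ} (σ : Equiv.Perm (Fin n)) (d : Fin n → ℂ) :
    Matrix (Fin n) (Fin n) ℂ :=
  Matrix.of fun k l => if l = σ k then d k else 0

lemma monomialMatrix_mulVec {n : ℕ} (σ : Equiv.Perm (Fin n)) (d v : Fin n → ℂ) (k : Fin n) :
    (monomialMatrix σ d).mulVec v k = d k * v (σ k) := by
  simp [monomialMatrix, Matrix.mulVec, dotProduct]

lemma isGrpn_monomialMatrix {n : ℕ} (σ : Equiv.Perm (Fin n)) {d : Fin n → ℂ}
    (hd : ∀ k, d k ^ 2 = 1) : IsGrpn 2 1 n (monomialMatrix σ d) := by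
  have hd0 : ∀ k, d k ≠ 0 := fun k h => by simpa [h] using hd k
  refine ⟨fun i => ⟨σ i, ?_, ?_⟩, fun j => ⟨σ.symm j, ?_, ?_⟩, fun i j h => ?_, ?_⟩
  · simp [monomialMatrix, hd0]
  · intro j hj
    by_contra h
    simp [monomialMatrix, h] at hj
  · simp [monomialMatrix, hd0]
  · intro i hi
    by_contra h
    exact hi (by simp [monomialMatrix, ← Equiv.symm_apply_eq, Ne.symm h])
  · by_cases hj : j = σ i
    · simp [monomialMatrix, hj, hd]
    · simp [monomialMatrix, hj] at h
  · simp [monomialMatrix, ← Finset.prod_pow, hd]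

/-- A point satisfying `uᵢ = ε uⱼ + t` with `ε = ±1`, `t ∈ ℤ + ℤζ` and `(i, ε) ≠ (j, 1)` lies on
the reflecting hyperplane given by that equation. -/
lemma exists_reflectingHyperplane {n : ℕ} {ζ : ℂ} {u : Fin n → ℂ} {i j : Fin n} {ε t : ℂ}
    (hε : ε ^ 2 = 1) (ht : t ∈ Zlat ζ) (hij : i = j → ε ≠ 1) (hu : u i = ε * u j + t) :
    ∃ H, IsReflectingHyperplane
      (fun g => IsGrpn 2 1 n g.1 ∧ g.2 ∈ stdLattice n ζ) H ∧ u ∈ H := by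
  have hsum : ∀ v : Fin n → ℂ,
      ∑ k, (Pi.single i 1 - Pi.single j ε : Fin n → ℂ) k * v k = v i - ε * v j := fun v => by
    simp [sub_mul, Finset.sum_sub_distrib, Pi.single_apply]
  have hε' : ε = 1 ∨ ε = -1 := by simpa using hε
  let g : Matrix (Fin n) (Fin n) ℂ × (Fin n → ℂ) :=
    (monomialMatrix (Equiv.swap i j) fun k => if k = i ∨ k = j then ε else 1,
      fun k => if k = i then t else if k = j then -ε * t else 0)
  refine ⟨{v | ∑ k, (Pi.single i 1 - Pi.single j ε : Fin n → ℂ) k * v k = t},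
    ⟨⟨_, fun h => ?_, t, rfl⟩, g, ⟨isGrpn_monomialMatrix _ fun k => ?_, ?_⟩,
      ⟨u + Pi.single i 1, fun h => ?_⟩, fun v hv => ?_⟩, ?_⟩
  · have h1 := congrFun h i
    rcases eq_or_ne i j with rfl | hne
    · simp [sub_eq_zero] at h1
      exact hij rfl h1.symm
    · simp [hne] at h1
  · split_ifs <;> simp [hε]
  · rw [mem_stdLattice_iff]
    intro k
    have ht' : t ∈ zlatSubgroup ζ := ht
    change _ ∈ zlatSubgroup ζ
    dsimp only [g]
    split_ifs
    · exact ht'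
    · rcases hε' with rfl | rfl <;> simpa using ht'
    · exact zero_mem _
  · have h1 := congrFun h i
    simp only [applyAff, g, Pi.add_apply, monomialMatrix_mulVec] at h1
    rcases eq_or_ne i j with rfl | hne
    · simp only [Equiv.swap_apply_left, Pi.single_eq_same, or_self, if_true] at h1
      exact hij rfl (by linear_combination h1 + hu)
    · simp [hne.symm] at h1
      exact one_ne_zero (by linear_combination -h1 - hu : (1 : ℂ) = 0)
  · rw [Set.mem_ofPred_eq, hsum] at hv
    ext k
    simp only [applyAff, g, Pi.add_apply, monomialMatrix_mulVec]
    by_cases hki : k = i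
    · subst hki
      simp
      linear_combination -hv
    · by_cases hkj : k = j
      · subst hkj
        simp [hki]
        linear_combination ε * hv + v k * hε
      · simp [hki, hkj, Equiv.swap_apply_of_ne_of_ne]
  · rw [Set.mem_ofPred_eq, hsum, hu]
    ring

/-- Steinberg's theorem for `[G(2,1,n)]₁ᵅ = W(Bₙ) ⋉ Λ` with lattice
`Λ = (ℤ + ℤα)e₁ + Σ_{j=2}^n (ℤ + ℤα)(e_{j-1} - e_j)`, `α ∉ ℝ`. -/
theorem steinberg_G_2_1_n_lattice1 (n : ℕ) (hn : 1 ≤ n)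
    (α : ℂ) (hα : α.im ≠ 0)
    (Λ : Set (Fin n → ℂ))
    (hΛ : Λ = {v | ∃ c : Fin n → ℂ, (∀ j, c j ∈ Zlat α) ∧ v = ∑ j, c j • stdGen n j}) :
    SteinbergProperty (fun g => IsGrpn 2 1 n g.1 ∧ g.2 ∈ Λ) := by
  subst hΛ
  rintro u ⟨⟨M, t⟩, ⟨⟨hrow, -, hsq, -⟩, ht⟩, ⟨v, hv⟩, hu⟩
  replace ht := mem_stdLattice_iff.mp ht
  choose σ hσ hσ_unique using hrow
  have hM : ∀ w i, M.mulVec w i = M i (σ i) * w (σ i) := fun w i =>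
    Finset.sum_eq_single_of_mem (f := fun j => M i j * w j) (σ i) (Finset.mem_univ _)
      fun j _ hj => mul_eq_zero_of_left (not_not.mp (mt (hσ_unique i j) hj)) _
  have hfix : ∀ i, u i = M i (σ i) * u (σ i) + t i := fun i => by
    have := congrFun hu i
    rw [applyAff, Pi.add_apply, hM] at this
    exact this.symm
  obtain ⟨i, hi⟩ : ∃ i, i = σ i → M i (σ i) ≠ 1 := by
    by_contra! h
    refine hv (funext fun i => ?_)
    have hti := hfix i
    rw [(h i).2, ← (h i).1] at hti
    rw [applyAff, Pi.add_apply, hM, (h i).2, ← (h i).1]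
    linear_combination -hti
  exact exists_reflectingHyperplane (hsq i _ (hσ i)) (ht i) hi (hfix i)
end
end

section
/- Let r, p, n be positive integers with p dividing r and n ≥ 2, and let Λ ⊆ ℂⁿ be a G(r,p,n)-invariant ℤ-lattice of full rank 2n with the property that for every λ ∈ Λ and every index 2 ≤ m ≤ n one has x_m(λ)·(e_m − e_{m-1}) ∈ Λ (this holds for all the lattices in Popov's classification). Let W = G(r,p,n) ⋉ Λ and suppose g ∈ W is an element whose linear part is the permutation matrix of a nontrivial cyclic permutation of {1,…,n}. Then every vector of ℂⁿ fixed by g lies on a reflecting hyperplane of W. -/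
open Matrix Complex

noncomputable section

/-- Permutation matrices belong to `G(r,p,n)`. -/
theorem isGrpn_permMatrix (r p n : ℕ) (ρ : Equiv.Perm (Fin n)) :
    IsGrpn r p n (ρ.permMatrix ℂ) := by
  have entry : ∀ i j, ρ.permMatrix ℂ i j = if ρ i = j then 1 else 0 := fun i j => by
    simp [Equiv.Perm.permMatrix, PEquiv.toMatrix_apply, Equiv.toPEquiv_apply, eq_comm]
  refine ⟨fun i => ⟨ρ i, by simp, fun j hj => ?_⟩,
    fun j => ⟨ρ.symm j, by simp, fun i hi => ?_⟩, fun i j hij => ?_, by simp⟩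
  · by_contra h
    exact hj (by simp [Ne.symm h])
  · by_contra h
    refine hi ?_
    rw [entry, if_neg fun h' => h (by simp [← h'])]
  · by_cases h : ρ i = j
    · simp [h]
    · exact absurd (by simp [h]) hij

/-- Any two ordered pairs of distinct elements are related by a permutation. -/
theorem exists_perm_map_pair {α : Type*} [DecidableEq α] {a b i j : α}
    (hab : a ≠ b) (hij : i ≠ j) : ∃ ρ : Equiv.Perm α, ρ a = i ∧ ρ b = j := by
  have hne : a ≠ Equiv.swap a i j := fun h => hij <| by
    simpa using congrArg (Equiv.swap a i) h
  exact ⟨(Equiv.swap b (Equiv.swap a i j)).trans (Equiv.swap a i),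
    by simp [Equiv.swap_apply_of_ne_of_ne hab hne], by simp⟩

/-- If `Λ` contains `c (e_i - e_j)`, then `x_i - x_j = c` is a reflecting hyperplane of
`G(r,p,n) ⋉ Λ`. -/
theorem isReflectingHyperplane_sub_eq (r p n : ℕ) (Λ : Set (Fin n → ℂ)) {i j : Fin n}
    (hij : i ≠ j) (c : ℂ)
    (hc : c • ((Pi.single i 1 : Fin n → ℂ) - (Pi.single j 1 : Fin n → ℂ)) ∈ Λ) :
    IsReflectingHyperplane (fun h => IsGrpn r p n h.1 ∧ h.2 ∈ Λ) {v | v i - v j = c} := by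
  refine ⟨⟨Pi.single i 1 - Pi.single j 1, fun h => ?_, c, ?_⟩,
    ((Equiv.swap i j).permMatrix ℂ, c • (Pi.single i 1 - Pi.single j 1)),
    ⟨isGrpn_permMatrix r p n _, hc⟩, ⟨Pi.single i (c + 1), fun h => ?_⟩, fun v hv => ?_⟩
  · simpa [hij] using congrFun h i
  · ext v
    simp [sub_mul, Finset.sum_sub_distrib, Pi.single_apply]
  · have := congrFun h i
    simp [applyAff, hij, hij.symm] at this
  · have hv' : v i - v j = c := hv
    ext k
    simp only [applyAff, Matrix.permMatrix_mulVec, Pi.add_apply, Function.comp_apply,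
      Pi.smul_apply, Pi.sub_apply, smul_eq_mul, ← hv']
    rcases eq_or_ne k i with rfl | hki
    · simp [hij]
    rcases eq_or_ne k j with rfl | hkj
    · simp [hij.symm]
    · simp [Equiv.swap_apply_of_ne_of_ne hki hkj, hki, hkj]

/-- If `g ∈ W = G(r,p,n) ⋉ Λ` has linear part the permutation matrix of a nontrivial
cycle, then every vector fixed by `g` lies on a reflecting hyperplane of `W`. -/
theorem fixed_by_cycle_lies_on_reflecting_hyperplane
    (r p n : ℕ) (hr : 0 < r) (hp : 0 < p) (hpr : p ∣ r) (hn : 2 ≤ n)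
    (Λ : Set (Fin n → ℂ))
    (hlat : ∃ b : Fin (2 * n) → (Fin n → ℂ), LinearIndependent ℝ b ∧
      Λ = {v | ∃ c : Fin (2 * n) → ℤ, v = ∑ i, (c i : ℂ) • b i})
    (hinv : ∀ M, IsGrpn r p n M → ∀ v ∈ Λ, M.mulVec v ∈ Λ)
    (hprop : ∀ v ∈ Λ, ∀ k : ℕ, ∀ hk : k + 1 < n,
      v ⟨k + 1, hk⟩ • ((Pi.single (⟨k + 1, hk⟩ : Fin n) (1 : ℂ) : Fin n → ℂ) -
        (Pi.single (⟨k, by omega⟩ : Fin n) (1 : ℂ) : Fin n → ℂ)) ∈ Λ)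
    (g : Matrix (Fin n) (Fin n) ℂ × (Fin n → ℂ))
    (hgW : IsGrpn r p n g.1 ∧ g.2 ∈ Λ)
    (σ : Equiv.Perm (Fin n)) (hσ : σ.IsCycle)
    (hglin : ∀ i j, g.1 i j = if j = σ i then 1 else 0) :
    ∀ u : Fin n → ℂ, applyAff g u = u →
      ∃ H, IsReflectingHyperplane (fun h => IsGrpn r p n h.1 ∧ h.2 ∈ Λ) H ∧ u ∈ H := by
  intro u hu
  obtain ⟨i, hi, -⟩ := hσ
  have hg : g.1 = σ.permMatrix ℂ := by
    ext i j
    simp [hglin, eq_comm]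
  have hui : u i - u (σ i) = g.2 i := by
    have := congrFun hu i
    simp only [applyAff, hg, Matrix.permMatrix_mulVec, Pi.add_apply, Function.comp_apply] at this
    rw [← this]
    ring
  refine ⟨_, isReflectingHyperplane_sub_eq r p n Λ (Ne.symm hi) (g.2 i) ?_, hui⟩
  obtain ⟨ρ, hρi, hρj⟩ := exists_perm_map_pair
    (a := (⟨0 + 1, by omega⟩ : Fin n)) (b := ⟨0, by omega⟩) (by simp) (Ne.symm hi)
  have hmem := hinv _ (isGrpn_permMatrix r p n ρ.symm) _
    (hprop _ (hinv _ (isGrpn_permMatrix r p n ρ) _ hgW.2) 0 (by omega))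
  convert hmem using 1
  ext k
  simp only [Matrix.permMatrix_mulVec, Function.comp_apply, hρi, Pi.smul_apply, Pi.sub_apply,
    Pi.single_apply, Equiv.symm_apply_eq, hρj]
end
end
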